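/- arXiv:1905.02628 — 5 statements merged into one kernel-verified Lean document; each statement's English description precedes it below -/
import Mathlib

section
/- The space ℓ∞(ι) has the metric extension property: if F and G are real Banach spaces, j : F → G is a linear isometry, ι is a nonempty index set, and t : F → ℓ∞(ι) is a bounded linear operator, then there exists a bounded linear operator s : G → ℓ∞(ι) such that s ∘ j = t and ‖s‖ = ‖t‖. -/
open scoped ENNReal

/-- Hahn–Banach extension of a functional along a linear isometry, preserving norm bounds. -/
theorem LinearIsometry.exists_dual_extension {F G : Type*} [NormedAddCommGroup F]
    [NormedSpace ℝ F] [NormedAddCommGroup G] [NormedSpace ℝ G] (j : F →ₗᵢ[ℝ] G)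
    (f : F →L[ℝ] ℝ) : ∃ g : G →L[ℝ] ℝ, (∀ x, g (j x) = f x) ∧ ‖g‖ ≤ ‖f‖ := by
  let e := j.equivRange
  obtain ⟨g, hg, hn⟩ := exists_extension_norm_eq (LinearMap.range j.toLinearMap)
    (f.comp e.symm.toLinearIsometry.toContinuousLinearMap)
  refine ⟨g, fun x => ?_, ?_⟩
  · have h := hg (e x)
    simpa [e] using h
  · rw [hn]
    refine ContinuousLinearMap.opNorm_le_bound _ (norm_nonneg f) fun y => ?_
    simpa using f.le_opNorm (e.symm y)

/-- A uniformly bounded family of functionals defines an operator into `ℓ∞`. -/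
theorem lp.exists_clm_of_forall_norm_le {G ι : Type*} [NormedAddCommGroup G] [NormedSpace ℝ G]
    (g : ι → G →L[ℝ] ℝ) {C : ℝ} (hC : 0 ≤ C) (hg : ∀ i, ‖g i‖ ≤ C) :
    ∃ s : G →L[ℝ] lp (fun _ : ι => ℝ) ∞, (∀ y i, s y i = g i y) ∧ ‖s‖ ≤ C := by
  have bound (y : G) (i : ι) : ‖g i y‖ ≤ C * ‖y‖ := (g i).le_of_opNorm_le (hg i) y
  let s : G →ₗ[ℝ] lp (fun _ : ι => ℝ) ∞ :=
    { toFun := fun y => ⟨fun i => g i y, memℓp_infty ⟨C * ‖y‖, by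
        rintro _ ⟨i, rfl⟩
        exact bound y i⟩⟩
      map_add' := fun x y => by ext i; exact map_add (g i) x y
      map_smul' := fun c y => by ext i; exact map_smul (g i) c y }
  have hs (y : G) : ‖s y‖ ≤ C * ‖y‖ :=
    lp.norm_le_of_forall_le (by positivity) (bound y)
  exact ⟨s.mkContinuous C hs, fun _ _ => rfl, s.mkContinuous_norm_le hC hs⟩

/-- `ℓ∞(ι)` has the metric extension property: every bounded linear operator
`t : F → ℓ∞(ι)` extends along any metric injection `j : F → G` to an operator
`s : G → ℓ∞(ι)` with `s ∘ j = t` and `‖s‖ = ‖t‖`. -/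
theorem stmt1 (F G : Type*) [NormedAddCommGroup F] [NormedSpace ℝ F] [CompleteSpace F]
    [NormedAddCommGroup G] [NormedSpace ℝ G] [CompleteSpace G]
    (ι : Type*) [Nonempty ι] (j : F →ₗᵢ[ℝ] G)
    (t : F →L[ℝ] lp (fun _ : ι => ℝ) ∞) :
    ∃ s : G →L[ℝ] lp (fun _ : ι => ℝ) ∞, (∀ x : F, s (j x) = t x) ∧ ‖s‖ = ‖t‖ := by
  have coord (i : ι) : ∃ g : G →L[ℝ] ℝ, (∀ x, g (j x) = t x i) ∧ ‖g‖ ≤ ‖t‖ := by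
    let f : F →ₗ[ℝ] ℝ :=
      { toFun := fun x => t x i
        map_add' := fun x y => by simp
        map_smul' := fun c x => by simp }
    have hf (x : F) : ‖f x‖ ≤ ‖t‖ * ‖x‖ :=
      (lp.norm_apply_le_norm ENNReal.top_ne_zero (t x) i).trans (t.le_opNorm x)
    obtain ⟨g, hg, hn⟩ := j.exists_dual_extension (f.mkContinuous ‖t‖ hf)
    exact ⟨g, hg, hn.trans (f.mkContinuous_norm_le (norm_nonneg t) hf)⟩
  choose g hg hn using coord
  obtain ⟨s, hs, hsn⟩ := lp.exists_clm_of_forall_norm_le g (norm_nonneg t) hn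
  have hst (x : F) : s (j x) = t x := by
    ext i
    rw [hs, hg]
  refine ⟨s, hst, hsn.antisymm ?_⟩
  refine t.opNorm_le_bound (norm_nonneg s) fun x => ?_
  rw [← hst, ← j.norm_map x]
  exact s.le_opNorm (j x)
end

section
/- Let E, F, G be real Banach spaces, u : E → F and v : E → G bounded linear operators, and C ≥ 0 a constant such that ‖v(x)‖ ≤ C·‖u(x)‖ for every x ∈ E. Then there exists a bounded linear operator w̃ : F → ℓ∞(B_{G*}) such that w̃(u(x)) = I_G(v(x)) for every x ∈ E and ‖w̃‖ ≤ C, where I_G : G → ℓ∞(B_{G*}), I_G(y) = (φ(y))_{φ ∈ B_{G*}}, is the canonical metric injection. -/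
open scoped ENNReal

/-- The canonical metric injection `I_G : G → ℓ∞(B_{G*})`, `I_G y = (φ y)_{φ ∈ B_{G*}}`. -/
noncomputable def canonicalInj (G : Type*) [NormedAddCommGroup G] [NormedSpace ℝ G] :
    G → lp (fun _ : (Metric.closedBall (0 : G →L[ℝ] ℝ) 1) => ℝ) ∞ := fun y =>
  ⟨fun φ => (φ : G →L[ℝ] ℝ) y, memℓp_infty ⟨‖y‖, by
    rintro r ⟨φ, rfl⟩
    calc ‖(φ : G →L[ℝ] ℝ) y‖ ≤ ‖(φ : G →L[ℝ] ℝ)‖ * ‖y‖ := (φ : G →L[ℝ] ℝ).le_opNorm y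
      _ ≤ 1 * ‖y‖ := by
          have hφ : ‖(φ : G →L[ℝ] ℝ)‖ ≤ 1 := by
            exact mem_closedBall_zero_iff.mp φ.2
          exact mul_le_mul_of_nonneg_right hφ (norm_nonneg y)
      _ = ‖y‖ := one_mul _⟩⟩

/-- A linear functional dominated by `C * ‖u x‖` factors through `u` as a continuous functional
of norm at most `C`. -/
theorem exists_dual_comp_eq_of_norm_le {E F : Type*} [AddCommGroup E] [Module ℝ E]
    [NormedAddCommGroup F] [NormedSpace ℝ F] (u : E →ₗ[ℝ] F) (f : E →ₗ[ℝ] ℝ) {C : ℝ}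
    (hC : 0 ≤ C) (h : ∀ x, ‖f x‖ ≤ C * ‖u x‖) :
    ∃ g : F →L[ℝ] ℝ, (∀ x, g (u x) = f x) ∧ ‖g‖ ≤ C := by
  have key : ∀ x, f.compLeftInverse u ⟨u x, x, rfl⟩ = f x := fun x =>
    LinearMap.compLeftInverse_apply_of_bdd f u ⟨C, h⟩ x (u x) rfl
  obtain ⟨g, hg, hgn⟩ := exists_extension_norm_eq (LinearMap.range u) (f.compLeftInverse u)
  refine ⟨g, fun x => (hg ⟨u x, x, rfl⟩).trans (key x), hgn.trans_le ?_⟩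
  refine ContinuousLinearMap.opNorm_le_bound _ hC ?_
  rintro ⟨_, x, rfl⟩
  rw [key x]
  exact h x

/-- A family of continuous functionals of norm at most `C` assembles into an operator into `ℓ∞` of
norm at most `C`. -/
theorem exists_clm_lp_infty_of_norm_le {F ι : Type*} [NormedAddCommGroup F] [NormedSpace ℝ F]
    (g : ι → F →L[ℝ] ℝ) {C : ℝ} (hC : 0 ≤ C) (hg : ∀ i, ‖g i‖ ≤ C) :
    ∃ w : F →L[ℝ] lp (fun _ : ι => ℝ) ∞, (∀ y i, w y i = g i y) ∧ ‖w‖ ≤ C := by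
  have hle : ∀ y i, ‖g i y‖ ≤ C * ‖y‖ := fun y i => (g i).le_of_opNorm_le (hg i) y
  let w₀ : F →ₗ[ℝ] lp (fun _ : ι => ℝ) ∞ :=
    { toFun := fun y => ⟨fun i => g i y, memℓp_infty ⟨C * ‖y‖, by rintro _ ⟨i, rfl⟩; exact hle y i⟩⟩
      map_add' := fun x y => by ext i; exact map_add (g i) x y
      map_smul' := fun c y => by ext i; exact map_smul (g i) c y }
  exact ⟨w₀.mkContinuous C fun y => lp.norm_le_of_forall_le (by positivity) (hle y),
    fun _ _ => rfl, w₀.mkContinuous_norm_le hC _⟩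

/-- If `‖v x‖ ≤ C * ‖u x‖` for all `x`, then there is a bounded linear operator
`w̃ : F → ℓ∞(B_{G*})` with `w̃ (u x) = I_G (v x)` and `‖w̃‖ ≤ C`. -/
theorem stmt3 (E F G : Type*) [NormedAddCommGroup E] [NormedSpace ℝ E] [CompleteSpace E]
    [NormedAddCommGroup F] [NormedSpace ℝ F] [CompleteSpace F]
    [NormedAddCommGroup G] [NormedSpace ℝ G] [CompleteSpace G]
    (u : E →L[ℝ] F) (v : E →L[ℝ] G) (C : ℝ) (hC : 0 ≤ C)
    (h : ∀ x : E, ‖v x‖ ≤ C * ‖u x‖) :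
    ∃ w : F →L[ℝ] lp (fun _ : (Metric.closedBall (0 : G →L[ℝ] ℝ) 1) => ℝ) ∞,
      (∀ x : E, w (u x) = canonicalInj G (v x)) ∧ ‖w‖ ≤ C := by
  have hφ : ∀ φ : Metric.closedBall (0 : G →L[ℝ] ℝ) 1, ∀ x,
      ‖(φ : G →L[ℝ] ℝ) (v x)‖ ≤ C * ‖u x‖ := fun φ x =>
    calc ‖(φ : G →L[ℝ] ℝ) (v x)‖ ≤ 1 * ‖v x‖ :=
          (φ : G →L[ℝ] ℝ).le_of_opNorm_le (mem_closedBall_zero_iff.mp φ.2) (v x)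
      _ = ‖v x‖ := one_mul _
      _ ≤ C * ‖u x‖ := h x
  choose g hgu hgC using fun φ : Metric.closedBall (0 : G →L[ℝ] ℝ) 1 =>
    exists_dual_comp_eq_of_norm_le (u : E →ₗ[ℝ] F)
      (((φ : G →L[ℝ] ℝ).comp v : E →L[ℝ] ℝ) : E →ₗ[ℝ] ℝ) hC (hφ φ)
  obtain ⟨w, hw, hwC⟩ := exists_clm_lp_infty_of_norm_le g hC hgC
  refine ⟨w, fun x => ?_, hwC⟩
  ext φ
  exact (hw (u x) φ).trans (hgu φ x)
end

section
/- The space ℓ¹ has the Schur property: if (x_n) is a sequence in ℓ¹ = ℓ¹(ℕ, ℝ) and x ∈ ℓ¹ are such that φ(x_n) → φ(x) for every continuous linear functional φ on ℓ¹ (i.e. x_n → x weakly), then ‖x_n − x‖₁ → 0 (i.e. x_n → x in norm). -/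
open Filter Topology

theorem hasSum_abs_lOne (y : lp (fun _ : ℕ => ℝ) 1) : HasSum (fun i => |y i|) ‖y‖ := by
  simpa using lp.hasSum_norm (by simp) y

theorem abs_mul_le_of_abs_le_one {b : ℕ → ℝ} (hb : ∀ i, |b i| ≤ 1) (y : ℕ → ℝ) (i : ℕ) :
    ‖b i * y i‖ ≤ |y i| := by
  rw [Real.norm_eq_abs, abs_mul]
  exact mul_le_of_le_one_left (abs_nonneg _) (hb i)

theorem summable_mul_lOne {b : ℕ → ℝ} (hb : ∀ i, |b i| ≤ 1) (y : lp (fun _ : ℕ => ℝ) 1) :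
    Summable fun i => b i * y i :=
  .of_norm_bounded (hasSum_abs_lOne y).summable (abs_mul_le_of_abs_le_one hb y)

/-- The functional on `ℓ¹` given by pairing with a sequence bounded by `1`. -/
noncomputable def lOnePairing (b : ℕ → ℝ) (hb : ∀ i, |b i| ≤ 1) :
    lp (fun _ : ℕ => ℝ) 1 →L[ℝ] ℝ :=
  LinearMap.mkContinuous
    { toFun := fun y => ∑' i, b i * y i
      map_add' := fun y z => by
        rw [← (summable_mul_lOne hb y).tsum_add (summable_mul_lOne hb z)]
        simp [mul_add]
      map_smul' := fun c y => by
        rw [RingHom.id_apply, smul_eq_mul, ← tsum_mul_left]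
        simp [mul_left_comm] }
    1 fun y => by
      rw [one_mul]
      exact tsum_of_norm_bounded (hasSum_abs_lOne y) (abs_mul_le_of_abs_le_one hb y)

/-- If every modification of `b₀` outside the finite set `I` pairs with `y` to at most `ε`, then
`‖y‖` exceeds `ε` by at most twice the mass of `y` on `I`. -/
theorem norm_lOne_le_of_pairing_le {b₀ : ℕ → Set.Icc (-1 : ℝ) 1} {I : Finset ℕ} {ε : ℝ}
    {y : lp (fun _ : ℕ => ℝ) 1}
    (h : ∀ b : ℕ → Set.Icc (-1 : ℝ) 1, (∀ i ∈ I, b i = b₀ i) → |∑' i, (b i : ℝ) * y i| ≤ ε) :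
    ‖y‖ ≤ ε + 2 * ∑ i ∈ I, |y i| := by
  have hsign (r : ℝ) : (SignType.sign r : ℝ) ∈ Set.Icc (-1 : ℝ) 1 := by
    cases SignType.sign r <;> simp
  let b : ℕ → Set.Icc (-1 : ℝ) 1 := fun i =>
    if i ∈ I then b₀ i else ⟨SignType.sign (y i), hsign (y i)⟩
  have hb (i : ℕ) : |(b i : ℝ)| ≤ 1 := abs_le.2 (b i).2
  have hI : HasSum (fun i => if i ∈ I then |y i| else 0) (∑ i ∈ I, |y i|) := by
    rw [← Finset.sum_congr rfl fun i (hi : i ∈ I) => if_pos (e := 0) hi]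
    exact hasSum_sum_of_ne_finset_zero fun i hi => if_neg hi
  have hle : ‖y‖ ≤ ∑' i, (b i : ℝ) * y i + 2 * ∑ i ∈ I, |y i| := by
    refine hasSum_le (fun i => ?_) (hasSum_abs_lOne y)
      ((summable_mul_lOne hb y).hasSum.add (hI.mul_left 2))
    by_cases hi : i ∈ I
    · have := (abs_le.1 (abs_mul_le_of_abs_le_one hb y i)).1
      simp only [hi, if_true]
      linarith
    · simp [b, hi, sign_mul_self]
  have := (abs_le.1 (h b fun i hi => if_pos hi)).2
  linarith

theorem tendsto_norm_lOne_of_tendsto_pairing {y : ℕ → lp (fun _ : ℕ => ℝ) 1}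
    (h : ∀ φ : lp (fun _ : ℕ => ℝ) 1 →L[ℝ] ℝ, Tendsto (fun n => φ (y n)) atTop (𝓝 0)) :
    Tendsto (fun n => ‖y n‖) atTop (𝓝 0) := by
  have hb (b : ℕ → Set.Icc (-1 : ℝ) 1) (i : ℕ) : |(b i : ℝ)| ≤ 1 := abs_le.2 (b i).2
  rw [Metric.tendsto_atTop']
  intro ε hε
  let F : ℕ → Set (ℕ → Set.Icc (-1 : ℝ) 1) := fun m =>
    ⋂ n ≥ m, {b | |∑' i, (b i : ℝ) * y n i| ≤ ε / 2}
  have hF (m : ℕ) : IsClosed (F m) := by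
    refine isClosed_biInter fun n _ => isClosed_le (Continuous.abs ?_) continuous_const
    exact continuous_tsum (fun i => by fun_prop) (hasSum_abs_lOne (y n)).summable
      fun i b => abs_mul_le_of_abs_le_one (hb b) (y n) i
  have hU : ⋃ m, F m = Set.univ := by
    refine Set.eq_univ_of_forall fun b => Set.mem_iUnion.2 ?_
    obtain ⟨m, hm⟩ := Metric.tendsto_atTop.1 (h (lOnePairing _ (hb b))) (ε / 2) (half_pos hε)
    refine ⟨m, Set.mem_iInter₂.2 fun n hn => ?_⟩
    have := hm n hn
    rw [Real.dist_0_eq_abs] at this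
    exact this.le
  have : Nonempty (Set.Icc (-1 : ℝ) 1) := ⟨⟨0, by simp⟩⟩
  obtain ⟨m, b₀, hb₀⟩ := nonempty_interior_of_iUnion_of_closed hF hU
  obtain ⟨I, u, hu, hsub⟩ := isOpen_pi_iff.1 isOpen_interior b₀ hb₀
  have hcoord : Tendsto (fun n => ∑ i ∈ I, |y n i|) atTop (𝓝 0) := by
    have : Tendsto (fun n => ∑ i ∈ I, |y n i|) atTop (𝓝 (∑ i ∈ I, |0|)) :=
      tendsto_finsetSum I fun i _ => (h (lp.evalCLM ℝ (fun _ : ℕ => ℝ) 1 i)).abs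
    simpa using this
  obtain ⟨k, hk⟩ := Metric.tendsto_atTop.1 hcoord (ε / 4) (by positivity)
  refine ⟨max m k, fun n hn => ?_⟩
  have hm : m ≤ n := (le_max_left m k).trans hn.le
  have hkn := hk n ((le_max_right m k).trans hn.le)
  rw [Real.dist_0_eq_abs] at hkn ⊢
  have := norm_lOne_le_of_pairing_le (b₀ := b₀) (I := I) (ε := ε / 2) (y := y n) fun b hbI =>
    Set.mem_iInter₂.1
      (interior_subset (hsub fun i hi => by rw [hbI i hi]; exact (hu i hi).2)) n hm
  rw [abs_of_nonneg (norm_nonneg _)]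
  linarith [(abs_lt.1 hkn).2]

/-- `ℓ¹` has the Schur property: weakly convergent sequences converge in norm. -/
theorem stmt6 (x : ℕ → lp (fun _ : ℕ => ℝ) 1) (x₀ : lp (fun _ : ℕ => ℝ) 1)
    (h : ∀ φ : lp (fun _ : ℕ => ℝ) 1 →L[ℝ] ℝ,
      Tendsto (fun n => φ (x n)) atTop (𝓝 (φ x₀))) :
    Tendsto (fun n => ‖x n - x₀‖) atTop (𝓝 0) := by
  refine tendsto_norm_lOne_of_tendsto_pairing fun φ => ?_
  simpa using (h φ).sub_const (φ x₀)
end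

section
/- Every bounded linear operator from ℓ¹ into a real normed space is completely continuous: if F is a real normed space, u : ℓ¹(ℕ, ℝ) → F is a bounded linear operator, and (x_n) is a sequence in ℓ¹ converging weakly to x ∈ ℓ¹ (i.e. φ(x_n) → φ(x) for every continuous linear functional φ on ℓ¹), then ‖u(x_n) − u(x)‖ → 0. -/
open Filter Topology

/-- A choice of signs, encoded by a Boolean: `true` is `1` and `false` is `-1`. -/
def boolSign (b : Bool) : ℝ := if b then 1 else -1

lemma abs_boolSign (b : Bool) : |boolSign b| = 1 := by
  cases b <;> simp [boolSign]

lemma boolSign_decide_nonneg_mul (a : ℝ) : boolSign (decide (0 ≤ a)) * a = |a| := by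
  by_cases h : 0 ≤ a
  · simp [boolSign, h, abs_of_nonneg]
  · simp [boolSign, h, abs_of_neg (not_le.mp h)]

namespace lp

lemma summable_abs (y : lp (fun _ : ℕ => ℝ) 1) : Summable fun j => |y j| := by
  simpa using (lp.memℓp y).summable (by simp)

lemma norm_eq_tsum_abs (y : lp (fun _ : ℕ => ℝ) 1) : ‖y‖ = ∑' j, |y j| := by
  simpa using lp.norm_eq_tsum_rpow (by simp) y

lemma norm_boolSign_mul (s : ℕ → Bool) (y : lp (fun _ : ℕ => ℝ) 1) (j : ℕ) :
    ‖boolSign (s j) * y j‖ = |y j| := by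
  rw [norm_mul, Real.norm_eq_abs, Real.norm_eq_abs, abs_boolSign, one_mul]

lemma summable_boolSign_mul (s : ℕ → Bool) (y : lp (fun _ : ℕ => ℝ) 1) :
    Summable fun j => boolSign (s j) * y j :=
  .of_norm <| by simpa only [norm_boolSign_mul] using summable_abs y

/-- The functional on `ℓ¹` given by pairing with a sequence of signs. -/
noncomputable def signPairing (s : ℕ → Bool) : lp (fun _ : ℕ => ℝ) 1 →L[ℝ] ℝ :=
  LinearMap.mkContinuous
    { toFun := fun y => ∑' j, boolSign (s j) * y j
      map_add' := fun y z => by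
        rw [← (summable_boolSign_mul s y).tsum_add (summable_boolSign_mul s z)]
        simp [mul_add]
      map_smul' := fun c y => by
        simp [← tsum_mul_left, mul_left_comm] }
    1 fun y => by
      rw [one_mul, norm_eq_tsum_abs]
      refine (norm_tsum_le_tsum_norm ?_).trans_eq ?_
      · simpa only [norm_boolSign_mul] using summable_abs y
      · simp only [norm_boolSign_mul]

lemma signPairing_apply (s : ℕ → Bool) (y : lp (fun _ : ℕ => ℝ) 1) :
    signPairing s y = ∑' j, boolSign (s j) * y j := rfl

lemma continuous_signPairing_apply (y : lp (fun _ : ℕ => ℝ) 1) :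
    Continuous fun s => signPairing s y := by
  simp only [signPairing_apply]
  refine continuous_tsum (fun j => ?_) (summable_abs y) fun j s => (norm_boolSign_mul s y j).le
  exact ((continuous_of_discreteTopology (f := boolSign)).comp (continuous_apply j)).mul_const _

/-- If every sign sequence agreeing with `s` below `k` pairs with `y` to at most `ε`, then the norm
of `y` is controlled by `ε` and its first `k` coordinates. -/
lemma norm_le_of_signPairing_le {s : ℕ → Bool} {k : ℕ} {ε : ℝ} {y : lp (fun _ : ℕ => ℝ) 1}
    (h : ∀ t ∈ PiNat.cylinder s k, signPairing t y ≤ ε) :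
    ‖y‖ ≤ ε + ∑ j ∈ Finset.range k, 2 * |y j| := by
  set t : ℕ → Bool := fun j => if j < k then s j else decide (0 ≤ y j) with ht
  have htk : signPairing t y ≤ ε := h t fun j hj => by simp [ht, hj]
  have hdiff : ‖y‖ - signPairing t y = ∑ j ∈ Finset.range k, (|y j| - boolSign (t j) * y j) := by
    rw [norm_eq_tsum_abs, signPairing_apply,
      ← (summable_abs y).tsum_sub (summable_boolSign_mul t y)]
    refine tsum_eq_sum fun j hj => ?_
    have hj : ¬ j < k := by simpa using hj
    simp only [ht, if_neg hj, boolSign_decide_nonneg_mul, sub_self]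
  have hle : ∑ j ∈ Finset.range k, (|y j| - boolSign (t j) * y j)
      ≤ ∑ j ∈ Finset.range k, 2 * |y j| := by
    refine Finset.sum_le_sum fun j _ => ?_
    have := neg_abs_le (boolSign (t j) * y j)
    rw [abs_mul, abs_boolSign] at this
    linarith
  linarith

/-- **Schur's property** of `ℓ¹`, for null sequences: weakly null sequences are norm null. -/
theorem tendsto_norm_zero_of_weakly_null {y : ℕ → lp (fun _ : ℕ => ℝ) 1}
    (h : ∀ φ : lp (fun _ : ℕ => ℝ) 1 →L[ℝ] ℝ, Tendsto (fun n => φ (y n)) atTop (𝓝 0)) :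
    Tendsto (fun n => ‖y n‖) atTop (𝓝 0) := by
  rw [Metric.tendsto_atTop']
  intro ε hε
  let A : ℕ → Set (ℕ → Bool) := fun N => {s | ∀ n ≥ N, |signPairing s (y n)| ≤ ε / 2}
  have hA_closed : ∀ N, IsClosed (A N) := fun N => by
    simp only [A, Set.ofPred_forall]
    exact isClosed_iInter fun n => isClosed_iInter fun _ =>
      isClosed_le (continuous_signPairing_apply (y n)).abs continuous_const
  have hA_union : ⋃ N, A N = Set.univ := by
    refine Set.eq_univ_of_forall fun s => Set.mem_iUnion.mpr ?_
    obtain ⟨N, hN⟩ := Metric.tendsto_atTop.mp (h (signPairing s)) (ε / 2) (half_pos hε)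
    exact ⟨N, fun n hn => by simpa using (hN n hn).le⟩
  obtain ⟨N, s, hs⟩ := nonempty_interior_of_iUnion_of_closed hA_closed hA_union
  obtain ⟨_, ⟨s', k, rfl⟩, -, hsub⟩ :=
    (PiNat.isTopologicalBasis_cylinders fun _ : ℕ => Bool).exists_subset_of_mem_open hs
      isOpen_interior
  have hcoord : Tendsto (fun n => ∑ j ∈ Finset.range k, 2 * |y n j|) atTop (𝓝 0) := by
    have := tendsto_finsetSum (Finset.range k) fun j _ =>
      ((h (lp.evalCLM ℝ (fun _ : ℕ => ℝ) 1 j)).abs.const_mul 2)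
    simpa [lp.evalCLM] using this
  obtain ⟨M, hM⟩ := Metric.tendsto_atTop.mp hcoord (ε / 2) (half_pos hε)
  refine ⟨max N M, fun n hn => ?_⟩
  have hnN : N ≤ n := (le_max_left N M).trans hn.le
  have hnM : M ≤ n := (le_max_right N M).trans hn.le
  have hbound := norm_le_of_signPairing_le (y := y n) (ε := ε / 2) fun t ht =>
    (le_abs_self _).trans (interior_subset (hsub ht) n hnN)
  have hsmall := hM n hnM
  rw [Real.dist_eq, sub_zero] at hsmall
  rw [Real.dist_eq, sub_zero, abs_norm]
  linarith [le_abs_self (∑ j ∈ Finset.range k, 2 * |y n j|)]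

end lp

/-- Every bounded linear operator from `ℓ¹` into a real normed space is completely
continuous: it sends weakly convergent sequences to norm convergent sequences. -/
theorem stmt7 (F : Type*) [NormedAddCommGroup F] [NormedSpace ℝ F]
    (u : lp (fun _ : ℕ => ℝ) 1 →L[ℝ] F)
    (x : ℕ → lp (fun _ : ℕ => ℝ) 1) (x₀ : lp (fun _ : ℕ => ℝ) 1)
    (h : ∀ φ : lp (fun _ : ℕ => ℝ) 1 →L[ℝ] ℝ,
      Tendsto (fun n => φ (x n)) atTop (𝓝 (φ x₀))) :
    Tendsto (fun n => ‖u (x n) - u x₀‖) atTop (𝓝 0) := by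
  have hnorm : Tendsto (fun n => ‖x n - x₀‖) atTop (𝓝 0) :=
    lp.tendsto_norm_zero_of_weakly_null fun φ => by
      simpa using (h φ).sub_const (φ x₀)
  refine squeeze_zero (fun _ => norm_nonneg _) (fun n => ?_) (by simpa using hnorm.const_mul ‖u‖)
  rw [← map_sub]
  exact u.le_opNorm _
end

section
/- The ideal of weakly compact operators is injective: let E, F, G be real Banach spaces, u : E → F a bounded linear operator, and j : F → G a linear isometry. If j ∘ u is weakly compact, i.e. the image of the closed unit ball of E under j ∘ u is contained in a weakly compact subset of G, then u is weakly compact, i.e. the image of the closed unit ball of E under u is contained in a weakly compact subset of F. -/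
/-- Every continuous functional on `F` extends along a linear isometry `F → G`. -/
theorem LinearIsometry.exists_strongDual_comp_eq {F G : Type*} [NormedAddCommGroup F]
    [NormedSpace ℝ F] [NormedAddCommGroup G] [NormedSpace ℝ G] (j : F →ₗᵢ[ℝ] G)
    (f : StrongDual ℝ F) : ∃ g : StrongDual ℝ G, ∀ x, g (j x) = f x := by
  obtain ⟨g, hg, -⟩ := exists_extension_norm_eq (LinearMap.range j.toLinearMap)
    (f ∘L (j.equivRange.symm : LinearMap.range j.toLinearMap →L[ℝ] F))
  refine ⟨g, fun x => (hg (j.equivRange x)).trans ?_⟩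
  simp

/-- A linear isometry is a topological embedding for the weak topologies. -/
theorem LinearIsometry.isEmbedding_weakSpaceMap {F G : Type*} [NormedAddCommGroup F]
    [NormedSpace ℝ F] [NormedAddCommGroup G] [NormedSpace ℝ G] (j : F →ₗᵢ[ℝ] G) :
    Topology.IsEmbedding (WeakSpace.map j.toContinuousLinearMap) := by
  refine ⟨⟨le_antisymm (WeakSpace.map j.toContinuousLinearMap).continuous.le_induced ?_⟩,
    j.injective⟩
  refine continuous_id_iff_le.1 (@WeakBilin.continuous_of_continuous_eval _ _ _ _ _ _ _ _ _ _
    (topDualPairing ℝ F).flip (TopologicalSpace.induced _ _) _ fun f => ?_)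
  obtain ⟨g, hg⟩ := j.exists_strongDual_comp_eq f
  have hcont : Continuous fun y : WeakSpace ℝ G => g y :=
    WeakBilin.eval_continuous (topDualPairing ℝ G).flip g
  have hcomp : (fun y : WeakSpace ℝ G => g y) ∘ WeakSpace.map j.toContinuousLinearMap =
      fun x : WeakSpace ℝ F => f x := funext hg
  exact hcomp ▸ @Continuous.comp (WeakSpace ℝ F) (WeakSpace ℝ G) ℝ (_) _ _ _ _ hcont
    continuous_induced_dom

/-- A linear isometry out of a Banach space is a closed embedding for the weak topologies. -/
theorem LinearIsometry.isClosedEmbedding_weakSpaceMap {F G : Type*} [NormedAddCommGroup F]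
    [NormedSpace ℝ F] [CompleteSpace F] [NormedAddCommGroup G] [NormedSpace ℝ G]
    (j : F →ₗᵢ[ℝ] G) :
    Topology.IsClosedEmbedding (WeakSpace.map j.toContinuousLinearMap) := by
  refine ⟨j.isEmbedding_weakSpaceMap, ?_⟩
  have hconv : Convex ℝ (Set.range j) := (LinearMap.range j.toLinearMap).convex
  have hclosed : IsClosed (Set.range j) := j.isometry.isClosedEmbedding.isClosed_range
  have himage := hconv.toWeakSpace_closure ℝ
  rw [hclosed.closure_eq] at himage
  have hrange : Set.range (WeakSpace.map j.toContinuousLinearMap) =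
      toWeakSpace ℝ G '' Set.range j := Set.range_comp (toWeakSpace ℝ G) j
  rw [hrange, himage]
  exact isClosed_closure

/-- The ideal of weakly compact operators is injective: if `j : F → G` is a metric
injection and `j ∘ u` maps the closed unit ball of `E` into a weakly compact subset
of `G`, then `u` maps the closed unit ball of `E` into a weakly compact subset of `F`. -/
theorem stmt12 (E F G : Type*) [NormedAddCommGroup E] [NormedSpace ℝ E] [CompleteSpace E]
    [NormedAddCommGroup F] [NormedSpace ℝ F] [CompleteSpace F]
    [NormedAddCommGroup G] [NormedSpace ℝ G] [CompleteSpace G]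
    (u : E →L[ℝ] F) (j : F →ₗᵢ[ℝ] G)
    (h : ∃ K : Set (WeakSpace ℝ G), IsCompact K ∧
      (fun x : E => toWeakSpace ℝ G (j (u x))) '' Metric.closedBall 0 1 ⊆ K) :
    ∃ K : Set (WeakSpace ℝ F), IsCompact K ∧
      (fun x : E => toWeakSpace ℝ F (u x)) '' Metric.closedBall 0 1 ⊆ K := by
  obtain ⟨K, hK, huK⟩ := h
  refine ⟨WeakSpace.map j.toContinuousLinearMap ⁻¹' K,
    j.isClosedEmbedding_weakSpaceMap.isCompact_preimage hK, ?_⟩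
  rintro _ ⟨x, hx, rfl⟩
  exact huK ⟨x, hx, rfl⟩
end
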